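/- arXiv:2409.00692 — 2 statements merged into one kernel-verified Lean document; each statement's English description precedes it below -/
import Mathlib

section
/- Let A_0, A_1, A_2, A_3, A_4 be a commutative association scheme on a finite nonempty set X with A_1ᵀ = A_1, A_2ᵀ = A_2 and A_3ᵀ = A_4. Suppose that the simple graph on X with adjacency matrix A_3 + A_4 is the disjoint union of N > 1 connected strongly regular graphs with the same data (w, k, r, s). Then at least one of the matrices A_1 + A_3, A_2 + A_3, A_3 has exactly 5 distinct eigenvalues. -/
open Matrix Polynomial

def IsZeroOne {X : Type*} (A : Matrix X X ℂ) : Prop :=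
  ∀ i j, A i j = 0 ∨ A i j = 1

def IsAssocScheme {X : Type*} [Fintype X] [DecidableEq X] {d : ℕ}
    (A : Fin (d+1) → Matrix X X ℂ) : Prop :=
  (∀ i, A i ≠ 0) ∧
  (∀ i, IsZeroOne (A i)) ∧
  A 0 = 1 ∧
  (∑ i, A i) = Matrix.of (fun _ _ => (1:ℂ)) ∧
  (∀ i, ∃ i', (A i)ᵀ = A i') ∧
  (∀ i j, A i * A j = A j * A i) ∧
  (∀ i j, ∃ p : Fin (d+1) → ℕ, A i * A j = ∑ l, (p l : ℂ) • A l)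

def Generates {X : Type*} [Fintype X] [DecidableEq X] {d : ℕ}
    (A : Fin (d+1) → Matrix X X ℂ) (B : Matrix X X ℂ) : Prop :=
  ∀ C ∈ Submodule.span ℂ (Set.range A), ∃ q : Polynomial ℂ, C = Polynomial.aeval B q

noncomputable def numDistinctEigen {X : Type*} [Fintype X] [DecidableEq X]
    (B : Matrix X X ℂ) : ℕ :=
  B.charpoly.roots.toFinset.card

def ArePrimIdem {X : Type*} [Fintype X] [DecidableEq X] {d : ℕ}
    (A E : Fin (d+1) → Matrix X X ℂ) : Prop :=
  (∀ i, E i ∈ Submodule.span ℂ (Set.range A)) ∧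
  E 0 = ((Fintype.card X : ℂ))⁻¹ • Matrix.of (fun _ _ => (1:ℂ)) ∧
  (∀ i j, E i * E j = if i = j then E i else 0) ∧
  (∑ i, E i) = 1 ∧
  (∀ i j, ∃ p : ℂ, A i * E j = p • E j)

def IsAmorphic {X : Type*} [Fintype X] [DecidableEq X] {d : ℕ}
    (A : Fin (d+1) → Matrix X X ℂ) : Prop :=
  ∀ (e : ℕ) (Λ : Fin (e+1) → Finset (Fin (d+1))),
    Λ 0 = {0} →
    (∀ i, (Λ i).Nonempty) →
    (∀ i j, i ≠ j → Disjoint (Λ i) (Λ j)) →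
    (∀ m, ∃ i, m ∈ Λ i) →
    ∀ i j, ∃ p : Fin (e+1) → ℕ,
      (∑ α ∈ Λ i, A α) * (∑ β ∈ Λ j, A β) = ∑ l, (p l : ℂ) • (∑ α ∈ Λ l, A α)

def HasForm12 {X : Type*} [Fintype X] [DecidableEq X] {d : ℕ}
    (A E : Fin (d+1) → Matrix X X ℂ) (k a b : Fin (d+1) → ℂ) : Prop :=
  ∀ i : Fin (d+1), i ≠ 0 →
    A i * E 0 = k i • E 0 ∧
    A i * E i = b i • E i ∧
    (∀ j : Fin (d+1), j ≠ 0 → j ≠ i → A i * E j = a i • E j) ∧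
    a i ≠ b i

def symmetrization {X : Type*} {d : ℕ} (A : Fin (d+2) → Matrix X X ℂ) :
    Fin (d+1) → Matrix X X ℂ :=
  fun i => if i = Fin.last d then A i.castSucc + A (Fin.last (d+1)) else A i.castSucc

def IsSRGGraph {V : Type*} (H : SimpleGraph V) (n k l m : ℕ) : Prop :=
  Nat.card V = n ∧
  (∀ v, (H.neighborSet v).ncard = k) ∧
  (∃ v w, H.Adj v w) ∧
  (∃ v w, v ≠ w ∧ ¬ H.Adj v w) ∧
  (∀ v w, H.Adj v w → ((H.neighborSet v) ∩ (H.neighborSet w)).ncard = l) ∧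
  (∀ v w, v ≠ w → ¬ H.Adj v w → ((H.neighborSet v) ∩ (H.neighborSet w)).ncard = m)

open Classical in
noncomputable def graphEigSet {V : Type*} [Fintype V] (H : SimpleGraph V) : Set ℂ :=
  ((Matrix.of (fun x y : V => if H.Adj x y then (1:ℂ) else 0)).charpoly.roots.toFinset : Set ℂ)

open Classical in
def IsDisjointUnionSRGs {V : Type*} [Fintype V] (G : SimpleGraph V)
    (N w k : ℕ) (r s : ℂ) : Prop :=
  Nat.card G.ConnectedComponent = N ∧
  r ≠ (k : ℂ) ∧ s ≠ (k : ℂ) ∧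
  ∀ c : G.ConnectedComponent,
    c.supp.ncard = w ∧
    (G.induce c.supp).Connected ∧
    (∃ l m : ℕ, IsSRGGraph (G.induce c.supp) w k l m) ∧
    graphEigSet (G.induce c.supp) = {(k : ℂ), r, s}

section Helpers

variable {X : Type*} [Fintype X] [DecidableEq X]

lemma aux_mem_roots (B : Matrix X X ℂ) (μ : ℂ) :
    μ ∈ B.charpoly.roots.toFinset ↔ ∃ v, v ≠ 0 ∧ B *ᵥ v = μ • v := by
  rw [Multiset.mem_toFinset, Polynomial.mem_roots (Matrix.charpoly_monic B).ne_zero,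
    ← Matrix.charpoly_toLin', ← Module.End.hasEigenvalue_iff_isRoot_charpoly]
  constructor
  · intro h
    obtain ⟨v, hv⟩ := h.exists_hasEigenvector
    exact ⟨v, hv.2, by simpa using hv.apply_eq_smul⟩
  · rintro ⟨v, hv, h⟩
    exact Module.End.hasEigenvalue_of_hasEigenvector
      (x := v) ⟨Module.End.mem_eigenspace_iff.2 (by simpa using h), hv⟩

open scoped ComplexOrder in
lemma aux_normal_ker (P : Matrix X X ℂ) (hP : P * Pᴴ = Pᴴ * P) (v : X → ℂ) :
    P *ᵥ v = 0 ↔ Pᴴ *ᵥ v = 0 := by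
  rw [← Matrix.conjTranspose_mul_self_mulVec_eq_zero, ← hP,
    Matrix.self_mul_conjTranspose_mulVec_eq_zero]

lemma aux_normal_sub (B : Matrix X X ℂ) (hB : B * Bᴴ = Bᴴ * B) (μ : ℂ) :
    (B - μ • 1) * (B - μ • 1)ᴴ = (B - μ • 1)ᴴ * (B - μ • 1) := by
  simp only [conjTranspose_sub, conjTranspose_smul, conjTranspose_one, sub_mul, mul_sub, hB,
    smul_mul_assoc, mul_smul_comm, one_mul, mul_one]
  module

open scoped ComplexOrder in
lemma aux_normal_pow (P : Matrix X X ℂ) (hP : P * Pᴴ = Pᴴ * P) (m : ℕ) (v : X → ℂ)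
    (h : (P ^ m) *ᵥ v = 0) : P *ᵥ v = 0 := by
  induction m generalizing v with
  | zero => 
    have : v = 0 := by simpa using h
    simp [this]
  | succ m ih =>
    rw [pow_succ, ← Matrix.mulVec_mulVec] at h
    have h1 := ih _ h
    rw [aux_normal_ker P hP, Matrix.mulVec_mulVec,
      Matrix.conjTranspose_mul_self_mulVec_eq_zero] at h1
    exact h1

lemma aux_eig_conj (B : Matrix X X ℂ) (hB : B * Bᴴ = Bᴴ * B) (μ : ℂ) (v : X → ℂ)
    (h : B *ᵥ v = μ • v) : Bᴴ *ᵥ v = (star μ) • v := by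
  have h1 : (B - μ • 1) *ᵥ v = 0 := by
    rw [Matrix.sub_mulVec, h, Matrix.smul_mulVec, Matrix.one_mulVec, sub_self]
  rw [aux_normal_ker _ (aux_normal_sub B hB μ)] at h1
  simpa [Matrix.sub_mulVec, Matrix.smul_mulVec, sub_eq_zero] using h1

/-- A matrix killing all eigenvectors of a normal matrix is zero. -/
lemma aux_kill (B : Matrix X X ℂ) (hB : B * Bᴴ = Bᴴ * B) (D : Matrix X X ℂ)
    (h : ∀ (μ : ℂ) (v : X → ℂ), v ≠ 0 → B *ᵥ v = μ • v → D *ᵥ v = 0) : D = 0 := by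
  have key : (⊤ : Submodule ℂ (X → ℂ)) ≤ LinearMap.ker (Matrix.toLin' D) := by
    rw [← Module.End.iSup_maxGenEigenspace_eq_top (Matrix.toLin' B)]
    refine iSup_le fun μ => ?_
    intro v hv
    rw [Module.End.mem_maxGenEigenspace] at hv
    obtain ⟨m, hm⟩ := hv
    have e : Matrix.toLin' B - μ • (1 : Module.End ℂ (X → ℂ)) = Matrix.toLin' (B - μ • 1) := by
      ext; simp
    rw [e, ← Matrix.toLin'_pow, Matrix.toLin'_apply] at hm
    have h1 := aux_normal_pow _ (aux_normal_sub B hB μ) m v hm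
    have h2 : B *ᵥ v = μ • v := by
      simpa [Matrix.sub_mulVec, Matrix.smul_mulVec, sub_eq_zero] using h1
    rw [LinearMap.mem_ker, Matrix.toLin'_apply]
    by_cases hv0 : v = 0
    · simp [hv0]
    · exact h μ v hv0 h2
  have : Matrix.toLin' D = 0 := LinearMap.ker_eq_top.1 (top_le_iff.1 key)
  simpa using this

lemma aux_lower (A : Fin 5 → Matrix X X ℂ) (hli : LinearIndependent ℂ A)
    (B : Matrix X X ℂ) (hB : B * Bᴴ = Bᴴ * B)
    (hf : ∀ μ : ℂ, ∃ f : Fin 5 → ℂ, ∀ v, B *ᵥ v = μ • v → ∀ i, A i *ᵥ v = f i • v) :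
    5 ≤ numDistinctEigen B := by
  choose f hf using hf
  let Φ : (Fin 5 → ℂ) →ₗ[ℂ] (B.charpoly.roots.toFinset → ℂ) :=
    { toFun := fun c μ => ∑ i, c i * f μ i
      map_add' := by intro c d; ext μ; simp [add_mul, Finset.sum_add_distrib]
      map_smul' := by intro c d; ext μ; simp [Finset.mul_sum, mul_assoc] }
  have hinj : Function.Injective Φ := by
    rw [← LinearMap.ker_eq_bot, LinearMap.ker_eq_bot']
    intro c hc
    have h0 : ∑ i, c i • A i = 0 := by
      apply aux_kill B hB
      intro μ v hv0 hv
      have hμ : μ ∈ B.charpoly.roots.toFinset := (aux_mem_roots B μ).2 ⟨v, hv0, hv⟩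
      have := congrFun hc ⟨μ, hμ⟩
      have h3 : ∑ i, c i * f μ i = 0 := this
      rw [Matrix.sum_mulVec]
      simp only [Matrix.smul_mulVec, hf μ v hv, smul_smul]
      rw [← Finset.sum_smul, h3, zero_smul]
    exact funext (Fintype.linearIndependent_iff.1 hli c h0)
  have := LinearMap.finrank_le_finrank_of_injective hinj
  simpa [numDistinctEigen] using this

lemma aux_pow (A : Fin 5 → Matrix X X ℂ) (h1 : A 0 = 1)
    (hmul : ∀ i j, A i * A j ∈ Submodule.span ℂ (Set.range A))
    (B : Matrix X X ℂ) (hB : B ∈ Submodule.span ℂ (Set.range A)) (m : ℕ) :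
    B ^ m ∈ Submodule.span ℂ (Set.range A) := by
  set M := Submodule.span ℂ (Set.range A) with hM
  have hMM : M * M ≤ M := by
    rw [hM, Submodule.span_mul_span, Submodule.span_le]
    rintro _ ⟨_, ⟨i, rfl⟩, _, ⟨j, rfl⟩, rfl⟩
    exact hmul i j
  induction m with
  | zero => rw [pow_zero, ← h1]; exact Submodule.subset_span ⟨0, rfl⟩
  | succ m ih => rw [pow_succ]; exact hMM (Submodule.mul_mem_mul ih hB)

lemma aux_upper (A : Fin 5 → Matrix X X ℂ) (h1 : A 0 = 1)
    (hmul : ∀ i j, A i * A j ∈ Submodule.span ℂ (Set.range A))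
    (B : Matrix X X ℂ) (hB : B ∈ Submodule.span ℂ (Set.range A)) :
    numDistinctEigen B ≤ 5 := by
  set M := Submodule.span ℂ (Set.range A) with hM
  have hpow : ∀ m : ℕ, B ^ m ∈ M := aux_pow A h1 hmul B hB
  have hfr : Module.finrank ℂ M ≤ 5 := by
    exact (finrank_range_le_card (R := ℂ) A).trans (by simp)
  let Φ : (Fin 6 → ℂ) →ₗ[ℂ] M :=
    { toFun := fun c => ∑ i : Fin 6, c i • (⟨B ^ (i : ℕ), hpow i⟩ : M)
      map_add' := by intro c d; simp only [Pi.add_apply, add_smul, Finset.sum_add_distrib]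
      map_smul' := by intro c d; simp only [Pi.smul_apply, smul_eq_mul, RingHom.id_apply, Finset.smul_sum, smul_smul] }
  have hker : LinearMap.ker Φ ≠ ⊥ := by
    apply LinearMap.ker_ne_bot_of_finrank_lt
    simp; omega
  obtain ⟨c, hc, hc0⟩ := Submodule.exists_mem_ne_zero_of_ne_bot hker
  have hc' : ∑ i : Fin 6, c i • B ^ (i : ℕ) = 0 := by
    have := congrArg (Subtype.val) (LinearMap.mem_ker.1 hc)
    simpa [Φ] using this
  let p : Polynomial ℂ := ∑ i : Fin 6, Polynomial.monomial (i : ℕ) (c i)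
  have hpc : ∀ i : Fin 6, p.coeff i = c i := by
    intro i
    simp [p, Polynomial.coeff_monomial, Fin.val_inj]
  have hp0 : p ≠ 0 := by
    intro h
    apply hc0
    ext i
    rw [← hpc i, h]; simp
  have hdeg : p.natDegree ≤ 5 := by
    apply Polynomial.natDegree_sum_le_of_forall_le
    intro i _
    exact (Polynomial.natDegree_monomial_le _).trans (by omega)
  have hsub : B.charpoly.roots.toFinset ⊆ p.roots.toFinset := by
    intro μ hμ
    obtain ⟨v, hv0, hv⟩ := (aux_mem_roots B μ).1 hμ
    rw [Multiset.mem_toFinset, Polynomial.mem_roots hp0, Polynomial.IsRoot]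
    have hpw : ∀ m : ℕ, (B ^ m) *ᵥ v = μ ^ m • v := by
      intro m
      induction m with
      | zero => simp
      | succ m ih => rw [pow_succ, ← Matrix.mulVec_mulVec, hv, Matrix.mulVec_smul, ih, smul_smul,
          pow_succ, mul_comm]
    have h3 := congrArg (fun T => T *ᵥ v) hc'
    simp only [Matrix.sum_mulVec, Matrix.smul_mulVec, hpw, smul_smul, Matrix.zero_mulVec] at h3
    rw [← Finset.sum_smul] at h3
    have h4 := (smul_eq_zero.1 h3).resolve_right hv0
    simpa [p, Polynomial.eval_finsetSum] using h4
  unfold numDistinctEigen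
  calc _ ≤ p.roots.toFinset.card := Finset.card_le_card hsub
    _ ≤ p.roots.card := Multiset.toFinset_card_le _
    _ ≤ p.natDegree := Polynomial.card_roots' p
    _ ≤ 5 := hdeg

lemma aux_eig (J C D D' : Matrix X X ℂ) (n w d : ℝ) (hd : 0 ≤ d) (hw : 2 * d < w) (hn : w < n)
    (JJ : J * J = (n : ℂ) • J) (JC : J * C = (w : ℂ) • J) (CJ : C * J = (w : ℂ) • J)
    (CC : C * C = (w : ℂ) • C) (JD : J * D = (d : ℂ) • J) (CD : C * D = (d : ℂ) • C)
    (DC : D * C = (d : ℂ) • C) (DC' : D' * C = (d : ℂ) • C)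
    (hbound : ∀ (μ : ℂ) (v : X → ℂ), v ≠ 0 → D *ᵥ v = μ • v → ‖μ‖ ≤ d)
    (hconj : ∀ (μ : ℂ) (v : X → ℂ), D *ᵥ v = μ • v → D' *ᵥ v = star μ • v) (μ : ℂ) :
    ∃ q c e e' : ℂ, ∀ v : X → ℂ, (J - C + D) *ᵥ v = μ • v →
      J *ᵥ v = q • v ∧ C *ᵥ v = c • v ∧ D *ᵥ v = e • v ∧ D' *ᵥ v = e' • v := by
  have hw0 : (w : ℂ) ≠ 0 := by
    norm_cast; linarith
  have hD : ∀ v : X → ℂ, (J - C + D) *ᵥ v = μ • v → D *ᵥ v = μ • v - J *ᵥ v + C *ᵥ v := by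
    intro v hv
    rw [Matrix.add_mulVec, Matrix.sub_mulVec] at hv
    rw [← hv]; abel
  have hJ : ∀ v : X → ℂ, (J - C + D) *ᵥ v = μ • v →
      ((n : ℂ) - w + d - μ) • (J *ᵥ v) = 0 := by
    intro v hv
    have := congrArg (fun u => J *ᵥ u) hv
    simp only [Matrix.mulVec_smul] at this
    rw [Matrix.mulVec_mulVec] at this
    simp only [Matrix.mul_add, Matrix.mul_sub, JJ, JC, JD,
      Matrix.add_mulVec, Matrix.sub_mulVec, Matrix.smul_mulVec, Matrix.mulVec_smul] at this
    rw [sub_smul, ← this]; module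
  have hC : ∀ v : X → ℂ, (J - C + D) *ᵥ v = μ • v →
      (w : ℂ) • (J *ᵥ v) + ((d : ℂ) - w) • (C *ᵥ v) = μ • (C *ᵥ v) := by
    intro v hv
    have := congrArg (fun u => C *ᵥ u) hv
    simp only [Matrix.mulVec_smul] at this
    rw [Matrix.mulVec_mulVec] at this
    simp only [Matrix.mul_add, Matrix.mul_sub, CJ, CC, CD,
      Matrix.add_mulVec, Matrix.sub_mulVec, Matrix.smul_mulVec, Matrix.mulVec_smul] at this
    rw [← this]; module
  by_cases hμ : d < ‖μ‖
  · refine ⟨μ + w - d, w, d, d, fun v hv => ?_⟩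
    have hv' : v - (w : ℂ)⁻¹ • (C *ᵥ v) = 0 := by
      by_contra h0
      refine absurd (hbound μ _ h0 ?_) (not_le.2 hμ)
      have h1 : μ • (w : ℂ)⁻¹ • (C *ᵥ v) = J *ᵥ v + (w : ℂ)⁻¹ • (d : ℂ) • (C *ᵥ v) - C *ᵥ v := by
        rw [smul_comm, ← hC v hv, smul_add, smul_smul, inv_mul_cancel₀ hw0, sub_smul, smul_sub,
          smul_smul _ (w : ℂ), inv_mul_cancel₀ hw0]
        module
      rw [Matrix.mulVec_sub, Matrix.mulVec_smul, Matrix.mulVec_mulVec, DC, Matrix.smul_mulVec,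
        hD v hv, smul_sub, h1]
      abel
    have hCv : C *ᵥ v = (w : ℂ) • v := by
      rw [sub_eq_zero] at hv'
      conv_rhs => rw [hv']
      rw [smul_smul, mul_inv_cancel₀ hw0, one_smul]
    have hg : ∀ E : Matrix X X ℂ, E * C = (d : ℂ) • C → E *ᵥ v = (d : ℂ) • v := by
      intro E hE
      have h1 : (w : ℂ) • (E *ᵥ v) = (w : ℂ) • ((d : ℂ) • v) := by
        rw [← Matrix.mulVec_smul, ← hCv, Matrix.mulVec_mulVec, hE, Matrix.smul_mulVec, hCv,
          smul_comm]
      exact (smul_right_injective _ hw0) h1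
    refine ⟨?_, hCv, hg D DC, hg D' DC'⟩
    have := hD v hv
    rw [hg D DC, hCv] at this
    have h2 : J *ᵥ v = μ • v + (w : ℂ) • v - (d : ℂ) • v := by rw [this]; abel
    rw [h2]; module
  · push Not at hμ
    refine ⟨0, 0, μ, star μ, fun v hv => ?_⟩
    have hre : |μ.re| ≤ d := (Complex.abs_re_le_norm μ).trans hμ
    have hre2 := abs_le.1 hre
    have hJv : J *ᵥ v = 0 := by
      refine (smul_eq_zero.1 (hJ v hv)).resolve_left fun h => ?_
      have := congrArg Complex.re h
      simp at this
      linarith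
    have hCv : C *ᵥ v = 0 := by
      have h1 := hC v hv
      rw [hJv, smul_zero, zero_add, ← sub_eq_zero, ← sub_smul] at h1
      refine (smul_eq_zero.1 h1).resolve_left fun h => ?_
      have := congrArg Complex.re h
      simp at this
      linarith
    have hDv : D *ᵥ v = μ • v := by
      rw [hD v hv, hJv, hCv]; simp
    exact ⟨by simp [hJv], by simp [hCv], hDv, hconj μ v hDv⟩

lemma aux_bound (D : Matrix X X ℂ) (d : ℝ) (hd : ∀ x, ∑ y, ‖D x y‖ = d) (μ : ℂ) (v : X → ℂ)
    (hv0 : v ≠ 0) (hv : D *ᵥ v = μ • v) : ‖μ‖ ≤ d := by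
  have he : Module.End.HasEigenvalue (Matrix.toLin' D) μ :=
    Module.End.hasEigenvalue_of_hasEigenvector
      (x := v) ⟨Module.End.mem_eigenspace_iff.2 (by simpa using hv), hv0⟩
  obtain ⟨x, hx⟩ := eigenvalue_mem_ball he
  rw [mem_closedBall_iff_norm] at hx
  rw [← hd x, ← Finset.add_sum_erase _ _ (Finset.mem_univ x)]
  calc ‖μ‖ = ‖D x x + (μ - D x x)‖ := by congr 1; ring
    _ ≤ _ := (norm_add_le _ _).trans (by gcongr)

lemma aux_row [Nonempty X] (P : Matrix X X ℂ) (hP : IsZeroOne P)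
    (hc : P * Matrix.of (fun _ _ => (1:ℂ)) = Matrix.of (fun _ _ => (1:ℂ)) * P) :
    ∃ d : ℝ, 0 ≤ d ∧ (P ≠ 0 → 0 < d) ∧ (∀ x, ∑ y, ‖P x y‖ = d) ∧ (∀ x, ∑ y, P x y = d) ∧
      (∀ y, ∑ x, P x y = d) := by
  have h1 : ∀ x y, ∑ z, P x z = ∑ z, P z y := by
    intro x y
    have := congrFun (congrFun hc x) y
    simpa [Matrix.mul_apply] using this
  have hn : ∀ x y, P x y = ((‖P x y‖ : ℝ) : ℂ) := by
    intro x y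
    rcases hP x y with h | h <;> simp [h]
  let x0 : X := Classical.arbitrary X
  have hr : ∀ x, ∑ y, P x y = ((∑ y, ‖P x0 y‖ : ℝ) : ℂ) := by
    intro x
    rw [h1 x x0, ← h1 x0 x0]
    push_cast
    exact Finset.sum_congr rfl fun y _ => hn _ _
  have hnr : ∀ x, ∑ y, ‖P x y‖ = ∑ y, ‖P x0 y‖ := by
    intro x
    have h := hr x
    rw [Finset.sum_congr rfl fun y _ => hn x y] at h
    exact_mod_cast h
  refine ⟨∑ y, ‖P x0 y‖, by positivity, ?_, hnr, hr, fun y => (h1 x0 y).symm.trans (hr x0)⟩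
  intro hP0
  by_contra hneg
  have h0 : ∑ y, ‖P x0 y‖ = 0 := le_antisymm (not_lt.1 hneg) (by positivity)
  apply hP0
  ext x y
  have h2 := hnr x
  rw [h0, Finset.sum_eq_zero_iff_of_nonneg (fun _ _ => norm_nonneg _)] at h2
  simpa using h2 y (Finset.mem_univ y)

lemma aux_PC (R : X → X → Prop) (hR : Equivalence R) (C P : Matrix X X ℂ)
    (hC1 : ∀ x y, R x y → C x y = 1) (hC0 : ∀ x y, ¬ R x y → C x y = 0)
    (hP : ∀ x y, ¬ R x y → P x y = 0) (d : ℂ) (hd : ∀ x, ∑ y, P x y = d) :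
    P * C = d • C := by
  ext x y
  rw [Matrix.mul_apply, Matrix.smul_apply, ← hd x, smul_eq_mul, Finset.sum_mul]
  refine Finset.sum_congr rfl fun z _ => ?_
  by_cases h : R x z
  · congr 1
    by_cases h2 : R x y
    · rw [hC1 _ _ h2, hC1 _ _ (hR.trans (hR.symm h) h2)]
    · rw [hC0 _ _ h2, hC0 _ _ (fun h3 => h2 (hR.trans h h3))]
  · rw [hP _ _ h]; simp

lemma aux_core [Nonempty X] (A : Fin 5 → Matrix X X ℂ) (a b : Fin 5)
    (hne : ∀ i, A i ≠ 0) (hz : ∀ i, IsZeroOne (A i)) (h0 : A 0 = 1)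
    (hs : 1 + A a + A b + A 3 + A 4 = Matrix.of (fun _ _ => (1:ℂ)))
    (hcomm : ∀ i j, A i * A j = A j * A i)
    (hmul : ∀ i j, A i * A j ∈ Submodule.span ℂ (Set.range A))
    (hli : LinearIndependent ℂ A)
    (hb : (A b)ᵀ = A b) (h34 : (A 3)ᵀ = A 4)
    (hcov : ∀ i, i = 0 ∨ i = a ∨ i = b ∨ i = 3 ∨ i = 4)
    (R : X → X → Prop) (hR : Equivalence R)
    (hR1 : ∀ x y, R x y → A b x y = 0) (hR0 : ∀ x y, ¬ R x y → A b x y = 1) :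
    numDistinctEigen (A b + A 3) = 5 := by
  set J : Matrix X X ℂ := Matrix.of (fun _ _ => (1:ℂ)) with hJ
  have hJc : ∀ i, A i * J = J * A i := by
    intro i
    rw [← hs]
    simp only [mul_add, add_mul, hcomm i, one_mul, mul_one]
  have hconjT : ∀ i, (A i)ᴴ = (A i)ᵀ := by
    intro i
    ext x y
    rcases hz i y x with h | h <;> simp [Matrix.conjTranspose_apply, h]
  choose D hD0 hDpos hDn hDr hDc using fun i => aux_row (A i) (hz i) (hJc i)
  have hD4 : D 4 = D 3 := by
    have h1 := hDr 4 (Classical.arbitrary X)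
    rw [← h34] at h1
    simp only [Matrix.transpose_apply, hDc 3] at h1
    exact_mod_cast h1.symm
  have hPJ : ∀ (P : Matrix X X ℂ) (d : ℂ), (∀ x, ∑ y, P x y = d) → P * J = d • J := by
    intro P d h
    ext x y
    simp [Matrix.mul_apply, hJ, h]
  have hAJ : ∀ i, A i * J = (D i : ℂ) • J := fun i => hPJ _ _ (hDr i)
  set C : Matrix X X ℂ := J - A b with hC
  have hCs : C = 1 + A a + A 3 + A 4 := by
    rw [hC, ← hs]; abel
  have hC1 : ∀ x y, R x y → C x y = 1 := by
    intro x y h; simp [hC, hJ, hR1 x y h]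
  have hC0 : ∀ x y, ¬ R x y → C x y = 0 := by
    intro x y h; simp [hC, hJ, hR0 x y h]
  have hA34 : ∀ x y, ¬ R x y → A 3 x y = 0 ∧ A 4 x y = 0 := by
    intro x y h
    have h1 := hC0 x y h
    rw [hCs, ← h0] at h1
    simp only [Matrix.add_apply] at h1
    rcases hz 0 x y with e0 | e0 <;> rcases hz a x y with ea | ea <;>
      rcases hz 3 x y with e3 | e3 <;> rcases hz 4 x y with e4 | e4 <;>
      simp only [e0, ea, e3, e4] at h1 ⊢ <;> revert h1 <;> norm_num
  let w : ℝ := 1 + D a + 2 * D 3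
  have hCr : ∀ x, ∑ y, C x y = (w : ℂ) := by
    intro x
    simp only [hCs, Matrix.add_apply, Finset.sum_add_distrib, hDr, hD4]
    simp [Matrix.one_apply, w]
    ring
  have hCJ : C * J = (w : ℂ) • J := hPJ _ _ hCr
  have hJC : J * C = C * J := by
    rw [hCs]; simp only [mul_add, add_mul, hJc, mul_one, one_mul]
  have hJr : J = C + A b := by rw [hC]; abel
  have hJJ : J * J = ((w + D b : ℝ) : ℂ) • J := by
    conv_lhs => rw [hJr]
    rw [add_mul, ← hJr, hCJ, hAJ, ← add_smul]; push_cast; rfl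
  have hCA : ∀ i, C * A i = A i * C := by
    intro i
    rw [hC, sub_mul, mul_sub, hJc, hcomm]
  have hDC : A 3 * C = (D 3 : ℂ) • C :=
    aux_PC R hR C (A 3) hC1 hC0 (fun x y h => (hA34 x y h).1) _ (hDr 3)
  have hDC4 : A 4 * C = (D 3 : ℂ) • C := by
    rw [← hD4]
    exact aux_PC R hR C (A 4) hC1 hC0 (fun x y h => (hA34 x y h).2) _ (hDr 4)
  have hCC : C * C = (w : ℂ) • C := aux_PC R hR C C hC1 hC0 hC0 _ hCr
  have hn3 : A 3 * (A 3)ᴴ = (A 3)ᴴ * A 3 := by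
    rw [hconjT, h34, hcomm]
  have hB : J - C + A 3 = A b + A 3 := by rw [hC]; abel
  have hnB : (A b + A 3) * (A b + A 3)ᴴ = (A b + A 3)ᴴ * (A b + A 3) := by
    rw [Matrix.conjTranspose_add, hconjT, hconjT, h34, hb]
    simp only [mul_add, add_mul]
    rw [hcomm 3 4, hcomm 3 b, hcomm 4 b]; abel
  have hbpos := hDpos b (hne b)
  have heig := aux_eig J C (A 3) (A 4) (w + D b) w (D 3) (hD0 3)
    (by have := hD0 a; simp only [w]; linarith) (by linarith) hJJ (hJC.trans hCJ) hCJ hCC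
    ((hJc 3).symm.trans (hAJ 3)) ((hCA 3).trans hDC) hDC hDC4
    (fun μ v => aux_bound (A 3) _ (hDn 3) μ v)
    (fun μ v h => by
      have := aux_eig_conj (A 3) hn3 μ v h
      rwa [hconjT, h34] at this)
  apply le_antisymm
  · exact aux_upper A h0 hmul _ (Submodule.add_mem _ (Submodule.subset_span ⟨b, rfl⟩)
      (Submodule.subset_span ⟨3, rfl⟩))
  · apply aux_lower A hli _ hnB
    intro μ
    obtain ⟨q, c, e, e', h⟩ := heig μ
    have key : ∀ i, ∃ f : ℂ, ∀ v, (A b + A 3) *ᵥ v = μ • v → A i *ᵥ v = f • v := by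
      intro i
      rcases hcov i with rfl | rfl | rfl | rfl | rfl
      · exact ⟨1, fun v hv => by rw [h0]; simp⟩
      · refine ⟨c - 1 - e - e', fun v hv => ?_⟩
        rw [← hB] at hv
        obtain ⟨hq, hc, he, he'⟩ := h v hv
        have : A i = C - 1 - A 3 - A 4 := by rw [hCs]; abel
        rw [this]
        simp only [Matrix.sub_mulVec, hc, he, he', Matrix.one_mulVec]
        module
      · refine ⟨q - c, fun v hv => ?_⟩
        rw [← hB] at hv
        obtain ⟨hq, hc, he, he'⟩ := h v hv
        have : A i = J - C := by rw [hC]; abel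
        rw [this]
        simp only [Matrix.sub_mulVec, hc, hq]
        module
      · exact ⟨e, fun v hv => (h v (by rw [hB]; exact hv)).2.2.1⟩
      · exact ⟨e', fun v hv => (h v (by rw [hB]; exact hv)).2.2.2⟩
    choose f hf using key
    exact ⟨f, fun v hv i => hf i v hv⟩

end Helpers

theorem stmt16 {X : Type*} [Fintype X] [DecidableEq X] [Nonempty X]
    (A : Fin 5 → Matrix X X ℂ)
    (hA : IsAssocScheme A)
    (h1 : (A 1)ᵀ = A 1) (h2 : (A 2)ᵀ = A 2) (h34 : (A 3)ᵀ = A 4)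
    (G : SimpleGraph X) [DecidableRel G.Adj]
    (hG : ∀ x y, (A 3 + A 4) x y = if G.Adj x y then (1 : ℂ) else 0)
    (N w k : ℕ) (r s : ℂ) (hN : 1 < N)
    (hdu : IsDisjointUnionSRGs G N w k r s) :
    numDistinctEigen (A 1 + A 3) = 5 ∨ numDistinctEigen (A 2 + A 3) = 5 ∨
    numDistinctEigen (A 3) = 5 := by
  obtain ⟨hne, hz, h0, hs, -, hcomm, hp⟩ := hA
  have hmul : ∀ i j, A i * A j ∈ Submodule.span ℂ (Set.range A) := by
    intro i j
    obtain ⟨p, hp⟩ := hp i j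
    rw [hp]
    exact Submodule.sum_mem _ fun l _ =>
      Submodule.smul_mem _ _ (Submodule.subset_span ⟨l, rfl⟩)
  have hsum1 : ∀ x y, ∑ i, A i x y = 1 := by
    intro x y
    have := congrFun (congrFun hs x) y
    simpa [Matrix.sum_apply] using this
  have huniq : ∀ i j x y, A i x y = 1 → j ≠ i → A j x y = 0 := by
    intro i j x y hi hji
    have h := congrArg Complex.re (hsum1 x y)
    rw [← Finset.add_sum_erase _ _ (Finset.mem_univ i), hi, Complex.add_re, Complex.re_sum] at h
    have h2 : ∑ l ∈ Finset.univ.erase i, (A l x y).re = 0 := by linarith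
    rw [Finset.sum_eq_zero_iff_of_nonneg] at h2
    · have h3 := h2 j (by simp [hji])
      rcases hz j x y with h | h
      · exact h
      · rw [h] at h3; simp at h3
    · intro l _
      rcases hz l x y with h | h <;> simp [h]
  have hcover : ∀ x y, ∃ i, A i x y = 1 := by
    intro x y
    by_contra hcon
    push Not at hcon
    have : ∑ i, A i x y = 0 :=
      Finset.sum_eq_zero fun i _ => (hz i x y).resolve_right (hcon i)
    rw [hsum1] at this
    exact one_ne_zero this
  have hnz : ∀ i, ∃ x y, A i x y = 1 := by
    intro i
    by_contra hcon
    push Not at hcon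
    exact hne i (by ext x y; exact (hz i x y).resolve_right (hcon x y))
  have hli : LinearIndependent ℂ A := by
    rw [Fintype.linearIndependent_iff]
    intro c hc i
    obtain ⟨x, y, hxy⟩ := hnz i
    have h := congrFun (congrFun hc x) y
    simp only [Matrix.sum_apply, Matrix.smul_apply, smul_eq_mul, Matrix.zero_apply] at h
    rw [Finset.sum_eq_single i] at h
    · simpa [hxy] using h
    · intro j _ hji
      rw [huniq i j x y hxy hji, mul_zero]
    · simp
  have hSadj : A 3 + A 4 = G.adjMatrix ℂ := by
    ext x y
    rw [hG, SimpleGraph.adjMatrix_apply]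
  have hadj : ∀ x y, G.Adj x y ↔ (A 3 x y = 1 ∨ A 4 x y = 1) := by
    intro x y
    have h := hG x y
    rw [Matrix.add_apply] at h
    constructor
    · intro hxy
      rw [if_pos hxy] at h
      rcases hz 3 x y with h3 | h3
      · right; simpa [h3] using h
      · exact Or.inl h3
    · rintro (h3 | h3)
      · by_contra hxy
        rw [if_neg hxy, h3, huniq 3 4 x y h3 (by decide)] at h
        norm_num at h
      · by_contra hxy
        rw [if_neg hxy, h3, huniq 4 3 x y h3 (by decide)] at h
        norm_num at h
  have hconst : ∀ T ∈ Submodule.span ℂ (Set.range A), ∀ l x y x' y', A l x y = 1 →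
      A l x' y' = 1 → T x y = T x' y' := by
    intro T hT l x y x' y' hl hl'
    induction hT using Submodule.span_induction with
    | mem T hT =>
      obtain ⟨i, rfl⟩ := hT
      by_cases hi : i = l
      · rw [hi, hl, hl']
      · rw [huniq l i x y hl hi, huniq l i x' y' hl' hi]
    | zero => rfl
    | add S T _ _ hS hT => simp [hS, hT]
    | smul c T _ hT => simp [hT]
  have hreach : ∀ l x y x' y', A l x y = 1 → A l x' y' = 1 → G.Reachable x y →
      G.Reachable x' y' := by
    intro l x y x' y' hl hl' ⟨p⟩
    have hS : A 3 + A 4 ∈ Submodule.span ℂ (Set.range A) :=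
      Submodule.add_mem _ (Submodule.subset_span ⟨3, rfl⟩) (Submodule.subset_span ⟨4, rfl⟩)
    have h := hconst _ (aux_pow A h0 hmul _ hS p.length) l x y x' y' hl hl'
    rw [hSadj, SimpleGraph.adjMatrix_pow_apply_eq_card_walk,
      SimpleGraph.adjMatrix_pow_apply_eq_card_walk] at h
    have h' := Nat.cast_injective h
    have hpos : 0 < Fintype.card { q : G.Walk x y | q.length = p.length } :=
      Fintype.card_pos_iff.2 ⟨⟨p, rfl⟩⟩
    rw [h'] at hpos
    obtain ⟨q⟩ := Fintype.card_pos_iff.1 hpos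
    exact ⟨q.1⟩
  obtain ⟨hcard, -, -, hcomp⟩ := hdu
  obtain ⟨x', y', hnr⟩ : ∃ x y, ¬ G.Reachable x y := by
    by_contra hcon
    push Not at hcon
    have : Subsingleton G.ConnectedComponent := by
      constructor
      intro c c'
      induction c using SimpleGraph.ConnectedComponent.ind with | _ u =>
      induction c' using SimpleGraph.ConnectedComponent.ind with | _ v =>
      exact SimpleGraph.ConnectedComponent.eq.2 (hcon u v)
    have h1 : Nat.card G.ConnectedComponent ≤ 1 := Finite.card_le_one_iff_subsingleton.2 this
    omega
  obtain ⟨x, y, hxy, hna, hr⟩ : ∃ x y, x ≠ y ∧ ¬ G.Adj x y ∧ G.Reachable x y := by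
    obtain ⟨-, -, ⟨l, m, -, -, -, ⟨u, v, huv, hn⟩, -⟩, -⟩ :=
      hcomp (G.connectedComponentMk (Classical.arbitrary X))
    refine ⟨u.1, v.1, fun h => huv (Subtype.ext h), fun h => hn h, ?_⟩
    have hu := u.2
    have hv := v.2
    rw [SimpleGraph.ConnectedComponent.mem_supp_iff] at hu hv
    exact SimpleGraph.ConnectedComponent.eq.1 (hu.trans hv.symm)
  have h0r : ∀ x y, A 0 x y = 1 → x = y := by
    intro x y h
    by_contra hxy
    rw [h0, Matrix.one_apply_ne hxy] at h
    exact zero_ne_one h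
  have main : ∀ a b : Fin 5, 1 + A a + A b + A 3 + A 4 = Matrix.of (fun _ _ => (1:ℂ)) →
      (A b)ᵀ = A b → (∀ i, i = 0 ∨ i = a ∨ i = b ∨ i = 3 ∨ i = 4) → A a x y = 1 →
      A b x' y' = 1 → numDistinctEigen (A b + A 3) = 5 := by
    intro a b hab hb hcov hax hbx
    refine aux_core A a b hne hz h0 hab hcomm hmul hli hb h34 hcov G.Reachable
      G.reachable_is_equivalence ?_ ?_
    · intro u v huv
      exact (hz b u v).resolve_right fun h => hnr (hreach b u v x' y' h hbx huv)
    · intro u v huv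
      obtain ⟨i, hi⟩ := hcover u v
      rcases hcov i with rfl | rfl | rfl | rfl | rfl
      · exact absurd (h0r _ _ hi ▸ SimpleGraph.Reachable.refl u) huv
      · exact absurd (hreach i x y u v hax hi hr) huv
      · exact hi
      · exact absurd ((hadj u v).2 (Or.inl hi)).reachable huv
      · exact absurd ((hadj u v).2 (Or.inr hi)).reachable huv
  have hs' : 1 + A 1 + A 2 + A 3 + A 4 = Matrix.of (fun _ _ => (1:ℂ)) := by
    rw [← hs, Fin.sum_univ_five, h0]
  have e1 : A 1 x y = 1 ∨ A 2 x y = 1 := by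
    obtain ⟨i, hi⟩ := hcover x y
    have : i = 0 ∨ i = 1 ∨ i = 2 ∨ i = 3 ∨ i = 4 := by clear hi; revert i; decide
    rcases this with rfl | rfl | rfl | rfl | rfl
    · exact absurd (h0r _ _ hi) hxy
    · exact Or.inl hi
    · exact Or.inr hi
    · exact absurd ((hadj _ _).2 (Or.inl hi)) hna
    · exact absurd ((hadj _ _).2 (Or.inr hi)) hna
  have e2 : A 1 x' y' = 1 ∨ A 2 x' y' = 1 := by
    obtain ⟨i, hi⟩ := hcover x' y'
    have : i = 0 ∨ i = 1 ∨ i = 2 ∨ i = 3 ∨ i = 4 := by clear hi; revert i; decide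
    rcases this with rfl | rfl | rfl | rfl | rfl
    · exact absurd (h0r _ _ hi ▸ SimpleGraph.Reachable.refl x') hnr
    · exact Or.inl hi
    · exact Or.inr hi
    · exact absurd ((hadj _ _).2 (Or.inl hi)).reachable hnr
    · exact absurd ((hadj _ _).2 (Or.inr hi)).reachable hnr
  rcases e1 with e1 | e1 <;> rcases e2 with e2 | e2
  · exact absurd (hreach 1 x y x' y' e1 e2 hr) hnr
  · exact Or.inr (Or.inl (main 1 2 hs' h2 (by decide) e1 e2))
  · exact Or.inl (main 2 1 (by rw [← hs']; abel) h1 (by decide) e1 e2)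
  · exact absurd (hreach 2 x y x' y' e1 e2 hr) hnr
end

section
/- Let A_0, A_1, A_2, A_3, A_4 be a commutative association scheme on a finite nonempty set X with A_1ᵀ = A_1, A_2ᵀ = A_2 and A_3ᵀ = A_4. Suppose that at least one of the three matrices A_1, A_2, A_3 + A_4 has exactly 4 distinct eigenvalues. Then at least one of the matrices A_1 + A_3, A_2 + A_3, A_3 has exactly 5 distinct eigenvalues. -/
open Matrix Polynomial

def IsCh {X : Type*} [Fintype X] (A : Fin 5 → Matrix X X ℂ) (f : Fin 5 → ℂ) : Prop :=
  ∃ v : X → ℂ, v ≠ 0 ∧ ∀ i, A i *ᵥ v = f i • v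

section
variable {X : Type*} [Fintype X] [DecidableEq X] {A : Fin 5 → Matrix X X ℂ}

lemma IsCh.zero {f : Fin 5 → ℂ} (hf : IsCh A f) (h0 : A 0 = 1) : f 0 = 1 := by
  obtain ⟨v, hv, h⟩ := hf
  have := h 0
  rw [h0, one_mulVec] at this
  have h2 : (f 0 - 1) • v = 0 := by rw [sub_smul, ← this, one_smul, sub_self]
  rcases smul_eq_zero.1 h2 with h3 | h3
  · exact sub_eq_zero.1 h3
  · exact absurd h3 hv

lemma IsCh.mul {f : Fin 5 → ℂ} (hf : IsCh A f) {i j : Fin 5} {p : Fin 5 → ℕ}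
    (hp : A i * A j = ∑ l, (p l : ℂ) • A l) : f i * f j = ∑ l, (p l : ℂ) * f l := by
  obtain ⟨v, hv, h⟩ := hf
  have h1 : (A i * A j) *ᵥ v = (f i * f j) • v := by
    rw [← mulVec_mulVec, h j, mulVec_smul, h i, smul_smul, mul_comm]
  rw [hp, Matrix.sum_mulVec] at h1
  simp only [smul_mulVec, h, smul_smul, ← Finset.sum_smul] at h1
  have h2 : (f i * f j - ∑ l, (p l : ℂ) * f l) • v = 0 := by rw [sub_smul, ← h1, sub_self]
  rcases smul_eq_zero.1 h2 with h3 | h3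
  · exact sub_eq_zero.1 h3
  · exact absurd h3 hv

lemma mem_roots_iff (B : Matrix X X ℂ) (μ : ℂ) :
    μ ∈ B.charpoly.roots.toFinset ↔ ∃ v : X → ℂ, v ≠ 0 ∧ B *ᵥ v = μ • v := by
  rw [Multiset.mem_toFinset, Polynomial.mem_roots (Matrix.charpoly_monic B).ne_zero,
    ← Matrix.charpoly_toLin', ← Module.End.hasEigenvalue_iff_isRoot_charpoly]
  constructor
  · intro h
    obtain ⟨v, hv⟩ := h.exists_hasEigenvector
    exact ⟨v, hv.2, by simpa using hv.apply_eq_smul⟩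
  · rintro ⟨v, hv, h⟩
    exact Module.End.hasEigenvalue_of_hasEigenvector (x := v)
      ⟨by rw [Module.End.mem_eigenspace_iff]; simpa using h, hv⟩

lemma joint {V : Type*} [AddCommGroup V] [Module ℂ V] [FiniteDimensional ℂ V]
    (T : Fin 5 → Module.End ℂ V) (hT : ∀ i j, T i * T j = T j * T i)
    (W0 : Submodule ℂ V) (h0 : W0 ≠ ⊥) (hinv : ∀ j, ∀ w ∈ W0, T j w ∈ W0) (s : Finset (Fin 5)) :
    ∃ W : Submodule ℂ V, W ≠ ⊥ ∧ W ≤ W0 ∧ (∀ j, ∀ w ∈ W, T j w ∈ W) ∧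
      ∀ i ∈ s, ∃ μ : ℂ, ∀ w ∈ W, T i w = μ • w := by
  induction s using Finset.induction_on with
  | empty => exact ⟨W0, h0, le_rfl, hinv, by simp⟩
  | insert a s ha ih =>
    obtain ⟨W, hW, hle, hi, hs⟩ := ih
    have : Nontrivial W := Submodule.nontrivial_iff_ne_bot.2 hW
    obtain ⟨μ, hμ⟩ := Module.End.exists_eigenvalue ((T a).restrict (hi a))
    obtain ⟨x, hx⟩ := hμ.exists_hasEigenvector
    refine ⟨W ⊓ Module.End.eigenspace (T a) μ, ?_, inf_le_left.trans hle, ?_, ?_⟩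
    · intro hb
      have hxm : (x : V) ∈ W ⊓ Module.End.eigenspace (T a) μ := by
        refine ⟨x.2, ?_⟩
        rw [SetLike.mem_coe, Module.End.mem_eigenspace_iff]
        have := congrArg Subtype.val hx.apply_eq_smul
        simpa using this
      rw [hb, Submodule.mem_bot] at hxm
      exact hx.2 (Subtype.ext hxm)
    · rintro j w ⟨hw1, hw2⟩
      refine ⟨hi j w hw1, ?_⟩
      rw [SetLike.mem_coe, Module.End.mem_eigenspace_iff] at hw2 ⊢
      have := congrArg (fun S => S w) (hT a j)
      simp only [Module.End.mul_apply] at this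
      rw [this, hw2, map_smul]
    · intro i his
      rcases Finset.mem_insert.1 his with rfl | h
      · exact ⟨μ, fun w hw => Module.End.mem_eigenspace_iff.1 hw.2⟩
      · obtain ⟨ν, hν⟩ := hs i h
        exact ⟨ν, fun w hw => hν w hw.1⟩

lemma IsCh.comb {f : Fin 5 → ℂ} {v : X → ℂ} (h : ∀ i, A i *ᵥ v = f i • v) (c : Fin 5 → ℂ) :
    (∑ i, c i • A i) *ᵥ v = (∑ i, c i * f i) • v := by
  rw [Matrix.sum_mulVec]
  simp only [smul_mulVec, h, smul_smul, ← Finset.sum_smul]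

lemma eig_iff (hc : ∀ i j, A i * A j = A j * A i) (c : Fin 5 → ℂ) (μ : ℂ) :
    μ ∈ (∑ i, c i • A i).charpoly.roots.toFinset ↔ ∃ f, IsCh A f ∧ ∑ i, c i * f i = μ := by
  rw [mem_roots_iff]
  constructor
  · rintro ⟨v, hv, h⟩
    set B := ∑ i, c i • A i with hB
    have hBc : ∀ j, B * A j = A j * B := by
      intro j
      rw [hB, Finset.sum_mul, Finset.mul_sum]
      refine Finset.sum_congr rfl fun i _ => ?_
      rw [smul_mul_assoc, mul_smul_comm, hc]
    obtain ⟨W, hW, hle, -, hs⟩ := joint (fun i => Matrix.toLin' (A i))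
      (fun i j => by
        rw [Module.End.mul_eq_comp, Module.End.mul_eq_comp, ← Matrix.toLin'_mul,
          ← Matrix.toLin'_mul, hc]) (Module.End.eigenspace (Matrix.toLin' B) μ)
      (by
        intro hb
        have : v ∈ Module.End.eigenspace (Matrix.toLin' B) μ := by
          rw [Module.End.mem_eigenspace_iff]; simpa using h
        rw [hb, Submodule.mem_bot] at this
        exact hv this)
      (by
        intro j w hw
        rw [Module.End.mem_eigenspace_iff] at hw ⊢
        simp only [Matrix.toLin'_apply] at hw ⊢
        rw [mulVec_mulVec, hBc, ← mulVec_mulVec, hw, mulVec_smul])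
      Finset.univ
    choose f hf using fun i => hs i (Finset.mem_univ i)
    obtain ⟨w, hw, hw0⟩ := (Submodule.ne_bot_iff W).1 hW
    have hfw : ∀ i, A i *ᵥ w = f i • w := fun i => by simpa using hf i w hw
    refine ⟨f, ⟨w, hw0, hfw⟩, ?_⟩
    have h1 := IsCh.comb hfw c
    have h2 := hle hw
    rw [Module.End.mem_eigenspace_iff, Matrix.toLin'_apply, hB, h1] at h2
    exact smul_left_injective ℂ hw0 h2
  · rintro ⟨f, ⟨v, hv, h⟩, rfl⟩
    exact ⟨v, hv, IsCh.comb h c⟩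

lemma ch_card (hA : IsAssocScheme A) {ι : Type} [Fintype ι] (g : ι → Fin 5 → ℂ)
    (hg : Function.Injective g) (hch : ∀ a, IsCh A (g a)) : Fintype.card ι ≤ 5 := by
  obtain ⟨-, -, h0, -, -, -, hp⟩ := hA
  choose p hp using hp
  have key : ∀ w : FreeMonoid (Fin 5), ∃ q : Fin 5 → ℂ, ∀ a,
      FreeMonoid.lift (g a) w = ∑ l, q l * g a l := by
    intro w
    induction w using FreeMonoid.inductionOn' with
    | one => exact ⟨fun l => if l = 0 then 1 else 0, fun a => by simp [(hch a).zero h0]⟩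
    | of_mul i w ih =>
      obtain ⟨q, hq⟩ := ih
      refine ⟨fun m => ∑ l, q l * p i l m, fun a => ?_⟩
      rw [map_mul, hq a, FreeMonoid.lift_eval_of, Finset.mul_sum]
      simp only [Finset.sum_mul]
      rw [Finset.sum_comm]
      refine Finset.sum_congr rfl fun l _ => ?_
      rw [mul_left_comm, (hch a).mul (hp i l), Finset.mul_sum]
      exact Finset.sum_congr rfl fun m _ => by ring
  choose q hq using key
  let L : (Fin 5 → ℂ) →ₗ[ℂ] (FreeMonoid (Fin 5) → ℂ) :=
    { toFun := fun x w => ∑ l, q w l * x l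
      map_add' := fun x y => by ext w; simp [mul_add, Finset.sum_add_distrib]
      map_smul' := fun c x => by
        ext w; simp only [Pi.smul_apply, smul_eq_mul, RingHom.id_apply, Finset.mul_sum]
        exact Finset.sum_congr rfl fun m _ => by ring }
  have hL : LinearIndependent ℂ (fun a => ((FreeMonoid.lift (g a) : FreeMonoid (Fin 5) →* ℂ) : FreeMonoid (Fin 5) → ℂ)) := by
    refine (linearIndependent_monoidHom (FreeMonoid (Fin 5)) ℂ).comp
      (fun a => FreeMonoid.lift (g a)) ?_
    intro a b hab
    exact hg (FreeMonoid.lift.injective hab)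
  have hL2 : LinearIndependent ℂ (L ∘ g) := by
    convert hL using 1
    ext a w
    exact (hq w a).symm
  have := (LinearIndependent.of_comp L hL2).fintype_card_le_finrank
  simpa using this

lemma num_eq5 (hA : IsAssocScheme A) (c : Fin 5 → ℂ) (g : Fin 5 → Fin 5 → ℂ)
    (hch : ∀ a, IsCh A (g a)) (hinj : Function.Injective fun a => ∑ i, c i * g a i) :
    numDistinctEigen (∑ i, c i • A i) = 5 := by
  have hc := hA.2.2.2.2.2.1
  unfold numDistinctEigen
  apply le_antisymm
  · have : ∀ r : (∑ i, c i • A i).charpoly.roots.toFinset, ∃ f, IsCh A f ∧ ∑ i, c i * f i = r :=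
      fun r => (eig_iff hc c r).1 r.2
    choose F hF1 hF2 using this
    have := ch_card hA F (fun a b hab => Subtype.ext (by rw [← hF2 a, ← hF2 b, hab])) hF1
    simpa using this
  · have := Finset.card_le_card_of_injOn (s := (Finset.univ : Finset (Fin 5)))
      (t := (∑ i, c i • A i).charpoly.roots.toFinset) (fun a => ∑ i, c i * g a i)
      (fun a _ => (eig_iff hc c _).2 ⟨g a, hch a, rfl⟩) hinj.injOn
    simpa using this

lemma disj (hA : IsAssocScheme A) {i j : Fin 5} (hij : i ≠ j) (x y : X) :
    A i x y = 0 ∨ A j x y = 0 := by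
  obtain ⟨hne, h01, h0, hJ, ht, -, hp⟩ := hA
  have h := congrFun (congrFun hJ x) y
  rcases h01 i x y with hi | hi
  · exact Or.inl hi
  rcases h01 j x y with h1 | h1
  · exact Or.inr h1
  exfalso
  rw [Matrix.sum_apply, ← Finset.add_sum_erase _ _ (Finset.mem_univ i),
    ← Finset.add_sum_erase _ _ (Finset.mem_erase.2 ⟨hij.symm, Finset.mem_univ j⟩), hi, h1] at h
  simp only [of_apply] at h
  have hr := congrArg Complex.re h
  simp only [Complex.add_re, Complex.one_re, Complex.re_sum] at hr
  have : 0 ≤ ∑ l ∈ (Finset.univ.erase i).erase j, (A l x y).re :=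
    Finset.sum_nonneg fun l _ => by rcases h01 l x y with h | h <;> simp [h]
  linarith

lemma diag (hA : IsAssocScheme A) {i j : Fin 5} {p : Fin 5 → ℕ}
    (hp : A i * (A j)ᵀ = ∑ l, (p l : ℂ) • A l) (x : X) :
    ∑ y, A i x y * A j x y = p 0 := by
  have h := congrFun (congrFun hp x) x
  rw [Matrix.mul_apply, Matrix.sum_apply, Finset.sum_eq_single (0 : Fin 5)] at h
  · simpa [hA.2.2.1] using h
  · intro b _ hb
    rcases disj hA hb x x with h | h
    · simp [h]
    · rw [hA.2.2.1] at h
      simp at h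
  · simp

lemma row_sums (hA : IsAssocScheme A) : ∃ k : Fin 5 → ℕ, ∀ i x, ∑ y, A i x y = k i := by
  have hA' := hA
  obtain ⟨hne, h01, h0, hJ, ht, -, hp⟩ := hA
  choose t ht using ht
  choose p hp using hp
  refine ⟨fun i => p i (t i) 0, fun i x => ?_⟩
  have h := hp i (t i)
  rw [← ht] at h
  rw [← diag hA' h x]
  refine Finset.sum_congr rfl fun y _ => ?_
  rcases h01 i x y with h | h <;> simp [h]

variable {k : Fin 5 → ℕ}

lemma k_mem [Nonempty X] (hk : ∀ i x, ∑ y, A i x y = k i) : IsCh A (fun i => (k i : ℂ)) := by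
  refine ⟨fun _ => 1, ?_, fun i => ?_⟩
  · intro h
    have := congrFun h (Classical.arbitrary X)
    simp at this
  · ext x
    simp [mulVec, dotProduct, hk]

lemma k_pos (hA : IsAssocScheme A) (hk : ∀ i x, ∑ y, A i x y = k i) (i : Fin 5) : 0 < k i := by
  rcases Nat.eq_zero_or_pos (k i) with h | h
  · exfalso
    apply hA.1 i
    ext x y
    have h1 := hk i x
    rw [h] at h1
    have hr := congrArg Complex.re h1
    rw [Complex.re_sum] at hr
    have h2 := (Finset.sum_eq_zero_iff_of_nonneg (fun y _ => by
      rcases hA.2.1 i x y with h | h <;> simp [h])).1 (hr.trans (by simp)) y (Finset.mem_univ y)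
    rcases hA.2.1 i x y with h | h
    · simpa using h
    · rw [h] at h2; simp at h2
  · exact h

lemma IsCh.bound (hA : IsAssocScheme A) (hk : ∀ i x, ∑ y, A i x y = k i) {f : Fin 5 → ℂ}
    (hf : IsCh A f) (i : Fin 5) : ‖f i‖ ≤ k i := by
  obtain ⟨v, hv, h⟩ := hf
  obtain ⟨z, hz⟩ := Function.ne_iff.1 hv
  obtain ⟨x, -, hx⟩ := Finset.exists_max_image Finset.univ (fun x => ‖v x‖) ⟨z, Finset.mem_univ z⟩
  have hpos : 0 < ‖v x‖ := lt_of_lt_of_le (norm_pos_iff.2 hz) (hx z (Finset.mem_univ z))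
  have h1 := congrFun (h i) x
  simp only [mulVec, dotProduct, Pi.smul_apply, smul_eq_mul] at h1
  have hks : ∑ y, ‖A i x y‖ = k i := by
    have := congrArg Complex.re (hk i x)
    rw [Complex.re_sum] at this
    rw [← Complex.natCast_re (k i), ← this]
    refine Finset.sum_congr rfl fun y _ => ?_
    rcases hA.2.1 i x y with h | h <;> simp [h]
  have h2 : ‖f i‖ * ‖v x‖ ≤ k i * ‖v x‖ := by
    rw [← norm_mul, ← h1, ← hks, Finset.sum_mul]
    refine (norm_sum_le _ _).trans (Finset.sum_le_sum fun y _ => ?_)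
    rw [norm_mul]
    exact mul_le_mul_of_nonneg_left (hx y (Finset.mem_univ y)) (norm_nonneg _)
  exact le_of_mul_le_mul_right h2 hpos

lemma conj_A (hA : IsAssocScheme A) (i : Fin 5) (x y : X) : star (A i x y) = A i x y := by
  rcases hA.2.1 i x y with h | h <;> simp [h]

open scoped ComplexOrder in
lemma IsCh.star_eq (hA : IsAssocScheme A) {f : Fin 5 → ℂ} (hf : IsCh A f) {i j : Fin 5}
    (hij : (A i)ᵀ = A j) : f j = star (f i) := by
  obtain ⟨v, hv, h⟩ := hf
  have hH : (A i)ᴴ = A j := by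
    rw [← hij]; ext x y; simp only [conjTranspose_apply, transpose_apply, conj_A hA]
  have h1 : star (A i *ᵥ v) ⬝ᵥ v = star v ⬝ᵥ (A j *ᵥ v) := by
    rw [star_mulVec, hH, dotProduct_mulVec]
  rw [h i, h j, star_smul, smul_dotProduct, dotProduct_smul] at h1
  have h2 : star v ⬝ᵥ v ≠ 0 := fun h => hv (dotProduct_star_self_eq_zero.1 h)
  exact (mul_right_cancel₀ h2 h1).symm

lemma IsCh.conj (hA : IsAssocScheme A) {f : Fin 5 → ℂ} (hf : IsCh A f) :
    IsCh A (fun i => star (f i)) := by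
  obtain ⟨v, hv, h⟩ := hf
  refine ⟨star v, star_ne_zero.2 hv, fun i => ?_⟩
  ext x
  have := congrArg star (congrFun (h i) x)
  simp only [mulVec, dotProduct, Pi.smul_apply, smul_eq_mul, star_sum, star_mul', conj_A hA] at this ⊢
  exact this

lemma IsCh.sum_zero (hA : IsAssocScheme A) (hk : ∀ i x, ∑ y, A i x y = k i) {f : Fin 5 → ℂ}
    (hf : IsCh A f) {i : Fin 5} (hne : f i ≠ k i) : ∑ l, f l = 0 := by
  obtain ⟨v, hv, h⟩ := hf
  have hJ := hA.2.2.2.1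
  have h1 : (∑ l, A l) *ᵥ v = (∑ l, f l) • v := by
    rw [Matrix.sum_mulVec, Finset.sum_smul]; simp only [h]
  have h2 : A i *ᵥ ((∑ l, A l) *ᵥ v) = (k i : ℂ) • ((∑ l, A l) *ᵥ v) := by
    rw [hJ]
    ext x
    simp only [mulVec, dotProduct, of_apply, one_mul, Pi.smul_apply, smul_eq_mul]
    rw [← Finset.sum_mul, hk]
  rw [h1, mulVec_smul, h, smul_smul, smul_smul] at h2
  have h3 := smul_left_injective ℂ hv h2
  by_contra hs
  exact hne (mul_left_cancel₀ hs (h3.trans (mul_comm _ _)))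

lemma exists_nonreal (hA : IsAssocScheme A) (h34 : (A 3)ᵀ = A 4) :
    ∃ f, IsCh A f ∧ f 3 ≠ star (f 3) := by
  have hH3 : (A 3)ᴴ = A 4 := by
    rw [← h34]; ext x y; simp only [conjTranspose_apply, transpose_apply, conj_A hA]
  have hH4 : (A 4)ᴴ = A 3 := by rw [← hH3, conjTranspose_conjTranspose]
  let c : Fin 5 → ℂ := ![0, 0, 0, Complex.I, -Complex.I]
  have hc : ∑ i, c i • A i = Complex.I • (A 3 - A 4) := by
    simp [c, Fin.sum_univ_five, smul_sub, sub_eq_add_neg]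
  have hne : A 3 - A 4 ≠ 0 := by
    intro h
    apply hA.1 3
    ext x y
    have h2 := congrFun (congrFun (sub_eq_zero.1 h) x) y
    rcases disj hA (show (3 : Fin 5) ≠ 4 by decide) x y with h | h
    · simpa using h
    · simpa [h] using h2
  have hH : (Complex.I • (A 3 - A 4)).IsHermitian := by
    unfold Matrix.IsHermitian
    rw [conjTranspose_smul, conjTranspose_sub, hH3, hH4]
    simp [smul_sub]
    abel
  have : hH.eigenvalues ≠ 0 := by
    intro h
    rw [hH.eigenvalues_eq_zero_iff] at h
    rcases smul_eq_zero.1 h with h | h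
    · exact Complex.I_ne_zero h
    · exact hne h
  obtain ⟨a, ha⟩ := Function.ne_iff.1 this
  have hr : ((hH.eigenvalues a : ℝ) : ℂ) ∈ (∑ i, c i • A i).charpoly.roots.toFinset := by
    rw [hc, mem_roots_iff]
    refine ⟨(hH.eigenvectorBasis a).ofLp, ?_, by simpa using hH.mulVec_eigenvectorBasis a⟩
    intro h0
    exact hH.eigenvectorBasis.toBasis.ne_zero a (by ext x; simpa using congrFun h0 x)
  obtain ⟨f, hf, hs⟩ := (eig_iff hA.2.2.2.2.2.1 c _).1 hr
  refine ⟨f, hf, fun h => ha ?_⟩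
  rw [← hf.star_eq hA h34] at h
  simp [c, Fin.sum_univ_five, h] at hs
  simpa using hs.symm

end

lemma nd5 (s : ℂ → ℂ) (hs : ∀ z, s (s z) = z) {a b d e : ℂ} (ha : s a = a) (hb : s b = b)
    (hd : s d = d) (he : s e ≠ e) (n1 : a ≠ b) (n2 : a ≠ d) (n3 : b ≠ d) :
    [a, b, d, e, s e].Nodup := by
  have := hs e
  simp only [List.nodup_cons, List.mem_cons, List.not_mem_nil, or_false, not_false_eq_true,
    List.nodup_nil, and_true, not_or]
  and_intros <;> grind

lemma ndA {α : Type*} (ev t : α → ℂ) (s : ℂ → ℂ) (hs : ∀ z, s (s z) = z) {κ ψ ψ' f g h : α}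
    (hκ : t κ = s (t κ)) (hψ : t ψ ≠ s (t ψ)) (hψ' : t ψ' = s (t ψ)) (e : ev ψ' = ev ψ)
    (e2 : ev ψ = ev κ) (a1 : ev f ≠ ev κ) (a2 : ev g ≠ ev κ) (a3 : ev h ≠ ev κ)
    (a4 : ev f ≠ ev g) (a5 : ev f ≠ ev h) (a6 : ev g ≠ ev h) :
    [κ, ψ, ψ', f, g, h].Nodup := by
  have := hs (t ψ)
  simp only [List.nodup_cons, List.mem_cons, List.not_mem_nil, or_false, not_false_eq_true,
    List.nodup_nil, and_true, not_or]
  and_intros <;> grind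

lemma ndB {α : Type*} (ev t : α → ℂ) (s : ℂ → ℂ) (hs : ∀ z, s (s z) = z) {κ ψ ψ' f f' g : α}
    (hψ : t ψ ≠ s (t ψ)) (hψ' : t ψ' = s (t ψ)) (e : ev ψ' = ev ψ)
    (hf : t f ≠ s (t f)) (hf' : t f' = s (t f)) (e' : ev f' = ev f)
    (e2 : ev ψ ≠ ev κ) (a1 : ev f ≠ ev κ) (a2 : ev g ≠ ev κ) (a3 : ev f ≠ ev g)
    (a4 : ev f ≠ ev ψ) (a5 : ev g ≠ ev ψ) :
    [κ, ψ, ψ', f, f', g].Nodup := by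
  simp only [List.nodup_cons, List.mem_cons, List.not_mem_nil, or_false, not_false_eq_true,
    List.nodup_nil, and_true, not_or]
  and_intros <;> grind

lemma all6 {α : Type*} {P : α → Prop} {a b c d e f : α} (ha : P a) (hb : P b) (hc : P c)
    (hd : P d) (he : P e) (hf : P f) : ∀ x ∈ [a, b, c, d, e, f], P x := by
  simp [ha, hb, hc, hd, he, hf]

section
variable {X : Type*} [Fintype X] [DecidableEq X] {A : Fin 5 → Matrix X X ℂ} {k : Fin 5 → ℕ}

lemma ch_list (hA : IsAssocScheme A) (l : List (Fin 5 → ℂ)) (hl : l.Nodup)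
    (hch : ∀ f ∈ l, IsCh A f) : l.length ≤ 5 := by
  have := ch_card hA l.get (List.nodup_iff_injective_get.1 hl) (fun a => hch _ (List.get_mem l a))
  simpa using this

lemma four [Nonempty X] (hA : IsAssocScheme A) (h34 : (A 3)ᵀ = A 4)
    (hk : ∀ i x, ∑ y, A i x y = k i) (c : Fin 5 → ℂ)
    (hc : ∀ f, IsCh A f → ∑ i, c i * star (f i) = ∑ i, c i * f i)
    (hnum : numDistinctEigen (∑ i, c i • A i) = 4) :
    ∃ f g h, IsCh A f ∧ IsCh A g ∧ IsCh A h ∧ f 3 = star (f 3) ∧ g 3 = star (g 3) ∧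
      h 3 ≠ star (h 3) ∧ ([fun i => (k i : ℂ), f, g, h].map fun f => ∑ i, c i * f i).Nodup := by
  have hcomm := hA.2.2.2.2.2.1
  obtain ⟨ψ, hψ, hψ3⟩ := exists_nonreal hA h34
  have hκ := k_mem hk
  have hr := eig_iff hcomm c
  unfold numDistinctEigen at hnum
  set R := (∑ i, c i • A i).charpoly.roots.toFinset with hR
  clear_value R
  set κ : Fin 5 → ℂ := fun i => (k i : ℂ) with hκd
  have hκ3 : κ 3 = star (κ 3) := by simp [hκd]
  clear_value κ
  have hc' : ∀ f, IsCh A f → IsCh A (fun i => star (f i)) := fun f hf => hf.conj hA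
  have hb : ∀ f : Fin 5 → ℂ, (fun i => star (f i)) 3 = star (f 3) := fun f => rfl
  have hc2 : ∀ f, IsCh A f → (fun f : Fin 5 → ℂ => ∑ i, c i * f i) (fun i => star (f i)) =
    (fun f : Fin 5 → ℂ => ∑ i, c i * f i) f := hc
  have hr2 : ∀ μ, μ ∈ R ↔ ∃ f, IsCh A f ∧ (fun f : Fin 5 → ℂ => ∑ i, c i * f i) f = μ := hr
  generalize (fun f : Fin 5 → ℂ => ∑ i, c i * f i) = ev at *
  have hψ' := hc' ψ hψ
  have eψ' := hc2 ψ hψ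
  have bψ := hb ψ
  generalize (fun i => star (ψ i)) = ψ' at *
  have six := ch_list hA
  have hκR : ev κ ∈ R := (hr2 _).2 ⟨κ, hκ, rfl⟩
  have hψR : ev ψ ∈ R := (hr2 _).2 ⟨ψ, hψ, rfl⟩
  by_cases hτ : ev ψ = ev κ
  · exfalso
    have hcard : (R.erase (ev κ)).card = 3 := by rw [Finset.card_erase_of_mem hκR, hnum]
    obtain ⟨x, y, z, hxy, hxz, hyz, he⟩ := Finset.card_eq_three.1 hcard
    have hx : x ∈ R.erase (ev κ) := by simp [he]
    have hy : y ∈ R.erase (ev κ) := by simp [he]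
    have hz : z ∈ R.erase (ev κ) := by simp [he]
    rw [Finset.mem_erase] at hx hy hz
    obtain ⟨f, hf, rfl⟩ := (hr2 _).1 hx.2
    obtain ⟨g, hg, rfl⟩ := (hr2 _).1 hy.2
    obtain ⟨h, hh, rfl⟩ := (hr2 _).1 hz.2
    have := six [κ, ψ, ψ', f, g, h] 
      (ndA ev (fun f => f 3) star star_star hκ3 hψ3 bψ eψ' hτ hx.1 hy.1 hz.1 hxy hxz hyz)
      (all6 hκ hψ hψ' hf hg hh)
    simp at this
  · have hcard : ((R.erase (ev κ)).erase (ev ψ)).card = 2 := by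
      rw [Finset.card_erase_of_mem (Finset.mem_erase.2 ⟨hτ, hψR⟩),
        Finset.card_erase_of_mem hκR, hnum]
    obtain ⟨x, y, hxy, he⟩ := Finset.card_eq_two.1 hcard
    have hx : x ∈ (R.erase (ev κ)).erase (ev ψ) := by simp [he]
    have hy : y ∈ (R.erase (ev κ)).erase (ev ψ) := by simp [he]
    rw [Finset.mem_erase, Finset.mem_erase] at hx hy
    obtain ⟨f, hf, rfl⟩ := (hr2 _).1 hx.2.2
    obtain ⟨g, hg, rfl⟩ := (hr2 _).1 hy.2.2
    have aux : ∀ f g, IsCh A f → IsCh A g → ev f ≠ ev g → ev f ≠ ev κ → ev f ≠ ev ψ →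
        ev g ≠ ev κ → ev g ≠ ev ψ → f 3 = star (f 3) := by
      intro f g hf hg h1 h2 h3 h4 h5
      by_contra hn
      have hf' := hc' f hf
      have ef' := hc2 f hf
      have bf := hb f
      generalize (fun i => star (f i)) = f' at *
      have := six [κ, ψ, ψ', f, f', g] 
        (ndB ev (fun f => f 3) star star_star hψ3 bψ eψ' hn bf ef' hτ h2 h4 h1 h3 h5)
        (all6 hκ hψ hψ' hf hf' hg)
      simp at this
    refine ⟨f, g, ψ, hf, hg, hψ, aux f g hf hg hxy hx.2.1 hx.1 hy.2.1 hy.1,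
      aux g f hg hf hxy.symm hy.2.1 hy.1 hx.2.1 hx.1, hψ3, ?_⟩
    simp only [List.map_cons, List.map_nil, List.nodup_cons, List.mem_cons, List.not_mem_nil,
      or_false, not_false_eq_true, List.nodup_nil, and_true, not_or]
    exact ⟨⟨Ne.symm hx.2.1, Ne.symm hy.2.1, Ne.symm hτ⟩, ⟨hxy, hx.1⟩, hy.1⟩

lemma five [Nonempty X] (hA : IsAssocScheme A) (h1 : (A 1)ᵀ = A 1) (h2 : (A 2)ᵀ = A 2)
    (h34 : (A 3)ᵀ = A 4) (hk : ∀ i x, ∑ y, A i x y = k i) (c : Fin 5 → ℂ)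
    (hc : ∀ i, star (c i) = c i) (hc34 : c 3 ≠ c 4) {f g h : Fin 5 → ℂ}
    (hf : IsCh A f) (hg : IsCh A g) (hh : IsCh A h) (hf3 : f 3 = star (f 3))
    (hg3 : g 3 = star (g 3)) (hh3 : h 3 ≠ star (h 3))
    (n1 : ∑ i, c i * (k i : ℂ) ≠ ∑ i, c i * f i) (n2 : ∑ i, c i * (k i : ℂ) ≠ ∑ i, c i * g i)
    (n3 : ∑ i, c i * f i ≠ ∑ i, c i * g i) :
    numDistinctEigen (∑ i, c i • A i) = 5 := by
  have hst : ∀ f : Fin 5 → ℂ, ∑ i, c i * star (f i) = star (∑ i, c i * f i) := by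
    intro f
    rw [star_sum]
    exact Finset.sum_congr rfl fun i _ => by rw [star_mul', hc]
  have hreal : ∀ f, IsCh A f → f 3 = star (f 3) → star (∑ i, c i * f i) = ∑ i, c i * f i := by
    intro f hf h3
    rw [← hst]
    have e1 := hf.star_eq hA h1
    have e2 := hf.star_eq hA h2
    have e4 := hf.star_eq hA h34
    have e0 := hf.zero hA.2.2.1
    rw [← h3] at e4
    simp only [Fin.sum_univ_five, ← e1, ← e2, ← h3, e4, e0, star_one]
  have hnon : star (∑ i, c i * h i) ≠ ∑ i, c i * h i := by
    rw [← hst]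
    have e1 := hh.star_eq hA h1
    have e2 := hh.star_eq hA h2
    have e4 := hh.star_eq hA h34
    have e0 := hh.zero hA.2.2.1
    simp only [Fin.sum_univ_five, ← e1, ← e2, ← e4, e0, star_one]
    rw [e4, star_star]
    intro hE
    have : (c 3 - c 4) * (h 3 - star (h 3)) = 0 := by linear_combination -hE
    rcases mul_eq_zero.1 this with h | h
    · exact hc34 (sub_eq_zero.1 h)
    · exact hh3 (sub_eq_zero.1 h)
  have hkc := k_mem hk
  have rk := hreal _ hkc (by simp)
  have rf := hreal _ hf hf3
  have rg := hreal _ hg hg3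
  have hs := hst h
  have hss := star_star (∑ i, c i * h i)
  apply num_eq5 hA c ![fun i => (k i : ℂ), f, g, h, fun i => star (h i)]
  · intro a
    fin_cases a
    · exact hkc
    · exact hf
    · exact hg
    · exact hh
    · exact hh.conj hA
  · have : (fun a => ∑ i, c i * (![fun i => (k i : ℂ), f, g, h, fun i => star (h i)] : Fin 5 → Fin 5 → ℂ) a i)
      = ![∑ i, c i * (k i : ℂ), ∑ i, c i * f i, ∑ i, c i * g i, ∑ i, c i * h i,
        ∑ i, c i * star (h i)] := by
      ext a; fin_cases a <;> rfl
    rw [this, hs]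
    generalize ∑ i, c i * (k i : ℂ) = a at *
    generalize ∑ i, c i * f i = b at *
    generalize ∑ i, c i * g i = d at *
    generalize ∑ i, c i * h i = e at *
    rw [show (![a, b, d, e, star e] : Fin 5 → ℂ) = [a, b, d, e, star e].get from by
      ext a; fin_cases a <;> rfl, ← List.nodup_iff_injective_get]
    exact nd5 star star_star rk rf rg hnon n1 n2 n3

lemma eq_of_re {z : ℂ} {r : ℕ} (h1 : ‖z‖ ≤ r) (h2 : z.re = r) : z = r := by
  have h3 := Complex.sq_norm z
  rw [Complex.normSq_apply, h2] at h3
  have h4 : ‖z‖ ^ 2 ≤ (r : ℝ) ^ 2 := by gcongr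
  have h5 : z.im = 0 := by nlinarith
  apply Complex.ext <;> simp [h2, h5]

lemma closed [Nonempty X] (hA : IsAssocScheme A) (hk : ∀ i x, ∑ y, A i x y = k i)
    {f : Fin 5 → ℂ} (hf : IsCh A f) {i j : Fin 5} {p : Fin 5 → ℕ}
    (hp : A i * A j = ∑ l, (p l : ℂ) • A l) (hi : f i = k i) (hj : f j = k j) {l : Fin 5}
    (hl : f l ≠ k l) : p l = 0 := by
  have e1 := hf.mul hp
  have e2 := (k_mem hk).mul hp
  rw [hi, hj, e2] at e1
  have e3 := congrArg Complex.re e1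
  simp only [Complex.re_sum, Complex.mul_re, Complex.natCast_re, Complex.natCast_im, zero_mul,
    sub_zero] at e3
  have hb : ∀ m, (f m).re ≤ k m := fun m => (Complex.re_le_norm _).trans (hf.bound hA hk m)
  have e4 : ∑ m, (p m : ℝ) * (k m - (f m).re) = 0 := by
    simp only [mul_sub, Finset.sum_sub_distrib]; linarith
  have e5 := (Finset.sum_eq_zero_iff_of_nonneg (fun m _ =>
    mul_nonneg (Nat.cast_nonneg (p m)) (sub_nonneg.2 (hb m)))).1 e4 l (Finset.mem_univ l)
  rcases mul_eq_zero.1 e5 with h | h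
  · exact_mod_cast h
  · exact absurd (eq_of_re (hf.bound hA hk l) (by linarith)) hl

lemma key [Nonempty X] (hA : IsAssocScheme A)
    (h34 : (A 3)ᵀ = A 4) (hk : ∀ i x, ∑ y, A i x y = k i) {f g h : Fin 5 → ℂ}
    (hf : IsCh A f) (hg : IsCh A g) (hh : IsCh A h) (hg3 : g 3 = star (g 3))
    (hf3 : f 3 = k 3) (hgk : g 3 ≠ k 3) (n1 : f 1 ≠ k 1) (n2 : g 1 ≠ k 1) (n3 : h 1 ≠ k 1)
    (n4 : f 1 ≠ g 1) (n5 : f 1 ≠ h 1) (n6 : g 1 ≠ h 1) : False := by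
  have hkc := k_mem hk
  have kpos := k_pos hA hk
  obtain ⟨p, hp⟩ : ∃ p : Fin 5 → Fin 5 → Fin 5 → ℕ,
      ∀ i j, A i * A j = ∑ l, (p i j l : ℂ) • A l := by
    have := hA.2.2.2.2.2.2
    choose p hp using this
    exact ⟨p, hp⟩
  have k4 : (k 4 : ℂ) = k 3 := by simpa using hkc.star_eq hA h34
  have k0 : (k 0 : ℂ) = 1 := hkc.zero hA.2.2.1
  have hf4 : f 4 = k 4 := by rw [hf.star_eq hA h34, hf3, k4]; simp
  have hf0 : f 0 = k 0 := by rw [hf.zero hA.2.2.1, k0]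
  by_cases hf2 : f 2 = k 2
  · have step : ∀ i, f i = k i → ∀ φ, IsCh A φ → φ i * φ 1 = k i * φ 1 := by
      intro i hi φ hφ
      have e1 := hf.mul (hp i 1)
      have e2 := hkc.mul (hp i 1)
      have e3 := hφ.mul (hp i 1)
      simp only [Fin.sum_univ_five] at e1 e2 e3
      rw [hf0, hf2, hf3, hf4, hi] at e1
      have e4 : ((k i : ℂ) - p i 1 1) * (k 1 - f 1) = 0 := by linear_combination e2 - e1
      have e5 : (k i : ℂ) = p i 1 1 := by
        rcases mul_eq_zero.1 e4 with h | h
        · exact sub_eq_zero.1 h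
        · exact absurd (sub_eq_zero.1 h).symm n1
      have e6 : k i = p i 1 1 := by exact_mod_cast e5
      have e7 : k i * k 1 = p i 1 0 * k 0 + p i 1 1 * k 1 + p i 1 2 * k 2 + p i 1 3 * k 3
        + p i 1 4 * k 4 := by exact_mod_cast e2
      rw [← e6] at e7
      have z : ∀ l, p i 1 l * k l = 0 → p i 1 l = 0 := fun l hl => by
        rcases Nat.mul_eq_zero.1 hl with h | h
        · exact h
        · exact absurd h (kpos l).ne'
      have z0 := z 0 (by omega)
      have z2 := z 2 (by omega)
      have z3 := z 3 (by omega)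
      have z4 := z 4 (by omega)
      rw [z0, z2, z3, z4, ← e5] at e3
      rw [e3]; simp
    have fin : ∀ φ, IsCh A φ → φ 1 ≠ k 1 → φ 1 = 0 ∨ φ 1 = -(k 0 + k 2 + k 3 + k 4 : ℂ) := by
      intro φ hφ hn
      by_cases h0 : φ 1 = 0
      · exact Or.inl h0
      right
      have s := hφ.sum_zero hA hk hn
      simp only [Fin.sum_univ_five] at s
      rw [mul_right_cancel₀ h0 (step 0 hf0 φ hφ), mul_right_cancel₀ h0 (step 2 hf2 φ hφ),
        mul_right_cancel₀ h0 (step 3 hf3 φ hφ), mul_right_cancel₀ h0 (step 4 hf4 φ hφ)] at s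
      linear_combination s
    have a := fin f hf n1
    have b := fin g hg n2
    have c := fin h hh n3
    grind
  · have z1 := closed hA hk hf (hp 3 3) hf3 hf3 n1
    have z2 := closed hA hk hf (hp 3 3) hf3 hf3 hf2
    have y1 := closed hA hk hf (hp 3 4) hf3 hf4 n1
    have y2 := closed hA hk hf (hp 3 4) hf3 hf4 hf2
    have x : X := Classical.arbitrary X
    have hA4 : (A 4)ᵀ = A 3 := by rw [← h34, transpose_transpose]
    have z0 : (p 3 3 0 : ℂ) = 0 := by
      rw [← diag hA (i := 3) (j := 4) (by rw [hA4]; exact hp 3 3) x]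
      refine Finset.sum_eq_zero fun y _ => ?_
      rcases disj hA (show (3 : Fin 5) ≠ 4 by decide) x y with h | h <;> simp [h]
    have y0 : (p 3 4 0 : ℂ) = k 3 := by
      rw [← diag hA (i := 3) (j := 3) (by rw [h34]; exact hp 3 4) x, ← hk 3 x]
      refine Finset.sum_congr rfl fun y _ => ?_
      rcases hA.2.1 3 x y with h | h <;> simp [h]
    have k3 : (k 3 : ℂ) ≠ 0 := by exact_mod_cast (kpos 3).ne'
    have e1 := hkc.mul (hp 3 3)
    have e2 := hg.mul (hp 3 3)
    have e3 := hg.mul (hp 3 4)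
    have g4 : g 4 = g 3 := by rw [hg.star_eq hA h34, ← hg3]
    have g0 := hg.zero hA.2.2.1
    simp only [Fin.sum_univ_five, z0, z1, z2, k4, g4, Nat.cast_zero, zero_mul, zero_add] at e1 e2
    simp only [Fin.sum_univ_five, y0, y1, y2, g4, g0, Nat.cast_zero, zero_mul, add_zero,
      mul_one] at e3
    have e4 : (k 3 : ℂ) = p 3 3 3 + p 3 3 4 := mul_right_cancel₀ k3 (by linear_combination e1)
    have e5 : g 3 * (g 3 - k 3) = 0 := by linear_combination e2 - g 3 * e4
    have e6 : g 3 = 0 := by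
      rcases mul_eq_zero.1 e5 with h | h
      · exact h
      · exact absurd (sub_eq_zero.1 h) hgk
    rw [e6] at e3
    apply k3
    linear_combination -e3

lemma no_sum [Nonempty X] (hA : IsAssocScheme A) (hk : ∀ i x, ∑ y, A i x y = k i)
    {f : Fin 5 → ℂ} (hf : IsCh A f) (h : f 1 ≠ k 1) : (k 1 : ℂ) + k 3 ≠ f 1 + f 3 := by
  intro he
  have e := congrArg Complex.re he
  simp only [Complex.add_re, Complex.natCast_re] at e
  have b1 := (Complex.re_le_norm _).trans (hf.bound hA hk 1)
  have b3 := (Complex.re_le_norm _).trans (hf.bound hA hk 3)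
  exact h (eq_of_re (hf.bound hA hk 1) (by linarith))

lemma case1 [Nonempty X] (hA : IsAssocScheme A) (h1 : (A 1)ᵀ = A 1) (h2 : (A 2)ᵀ = A 2)
    (h34 : (A 3)ᵀ = A 4) (h4 : numDistinctEigen (A 1) = 4) :
    numDistinctEigen (A 1 + A 3) = 5 ∨ numDistinctEigen (A 3) = 5 := by
  obtain ⟨k, hk⟩ := row_sums hA
  obtain ⟨f, g, h, hf, hg, hh, hf3, hg3, hh3, hnd⟩ := four hA h34 hk ![0, 1, 0, 0, 0]
    (fun f hf => by
      simp only [Fin.sum_univ_five, ← hf.star_eq hA h1]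
      simp) (by simpa [Fin.sum_univ_five] using h4)
  simp [Fin.sum_univ_five] at hnd
  by_contra hcon
  push Not at hcon
  obtain ⟨c1, c3⟩ := hcon
  have F1 := five hA h1 h2 h34 hk ![0, 1, 0, 1, 0]
    (by intro i; fin_cases i <;> simp) (by simp) hf hg hh hf3 hg3 hh3
  have F3 := five hA h1 h2 h34 hk ![0, 0, 0, 1, 0]
    (by intro i; fin_cases i <;> simp) (by simp) hf hg hh hf3 hg3 hh3
  simp [Fin.sum_univ_five] at F1 F3
  have G1 : f 1 + f 3 = g 1 + g 3 := by
    by_contra hne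
    exact c1 (F1 (no_sum hA hk hf (by grind)) (no_sum hA hk hg (by grind)) hne)
  have hne : f 3 ≠ g 3 := fun e => by
    rw [e] at G1
    have := add_right_cancel G1
    grind
  by_cases ef : f 3 = k 3
  · exact key hA h34 hk hf hg hh hg3 ef (by rw [← ef]; exact hne.symm) (by grind) (by grind)
      (by grind) (by grind) (by grind) (by grind)
  by_cases eg : g 3 = k 3
  · exact key hA h34 hk hg hf hh hf3 eg (by rw [← eg]; exact hne) (by grind) (by grind)
      (by grind) (by grind) (by grind) (by grind)
  exact c3 (F3 (Ne.symm ef) (Ne.symm eg) hne)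

lemma case3 [Nonempty X] (hA : IsAssocScheme A) (h1 : (A 1)ᵀ = A 1) (h2 : (A 2)ᵀ = A 2)
    (h34 : (A 3)ᵀ = A 4) (h4 : numDistinctEigen (A 3 + A 4) = 4) :
    numDistinctEigen (A 3) = 5 := by
  obtain ⟨k, hk⟩ := row_sums hA
  have h43 : (A 4)ᵀ = A 3 := by rw [← h34, transpose_transpose]
  obtain ⟨f, g, h, hf, hg, hh, hf3, hg3, hh3, hnd⟩ := four hA h34 hk ![0, 0, 0, 1, 1]
    (fun f hf => by
      simp only [Fin.sum_univ_five, ← hf.star_eq hA h34, ← hf.star_eq hA h43]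
      simp [add_comm]) (by simpa [Fin.sum_univ_five] using h4)
  have f4 : f 4 = f 3 := by rw [hf.star_eq hA h34, ← hf3]
  have g4 : g 4 = g 3 := by rw [hg.star_eq hA h34, ← hg3]
  have k4 : (k 4 : ℂ) = k 3 := by simpa using (k_mem hk).star_eq hA h34
  simp [Fin.sum_univ_five, f4, g4, k4] at hnd
  have F3 := five hA h1 h2 h34 hk ![0, 0, 0, 1, 0]
    (by intro i; fin_cases i <;> simp) (by simp) hf hg hh hf3 hg3 hh3
  simp [Fin.sum_univ_five] at F3
  apply F3 <;> grind

lemma swap12 (hA : IsAssocScheme A) : IsAssocScheme (fun i : Fin 5 => A (Equiv.swap 1 2 i)) := by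
  obtain ⟨hne, h01, h0, hJ, ht, hc, hp⟩ := hA
  refine ⟨fun i => hne _, fun i => h01 _, ?_, ?_, fun i => ?_, fun i j => hc _ _, fun i j => ?_⟩
  · rw [← h0]; rfl
  · rw [← hJ]
    exact Equiv.sum_comp (Equiv.swap (1 : Fin 5) 2) A
  · obtain ⟨j, hj⟩ := ht (Equiv.swap (1 : Fin 5) 2 i)
    exact ⟨Equiv.swap (1 : Fin 5) 2 j, by simp only [hj, Equiv.swap_apply_self]⟩
  · obtain ⟨p, h⟩ := hp (Equiv.swap (1 : Fin 5) 2 i) (Equiv.swap (1 : Fin 5) 2 j)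
    refine ⟨fun l => p (Equiv.swap (1 : Fin 5) 2 l), ?_⟩
    rw [h]
    exact (Equiv.sum_comp (Equiv.swap (1 : Fin 5) 2) (fun l => (p l : ℂ) • A l)).symm

end

theorem stmt17 {X : Type*} [Fintype X] [DecidableEq X] [Nonempty X]
    (A : Fin 5 → Matrix X X ℂ)
    (hA : IsAssocScheme A)
    (h1 : (A 1)ᵀ = A 1) (h2 : (A 2)ᵀ = A 2) (h34 : (A 3)ᵀ = A 4)
    (h4 : numDistinctEigen (A 1) = 4 ∨ numDistinctEigen (A 2) = 4 ∨
          numDistinctEigen (A 3 + A 4) = 4) :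
    numDistinctEigen (A 1 + A 3) = 5 ∨ numDistinctEigen (A 2 + A 3) = 5 ∨
    numDistinctEigen (A 3) = 5 := by
  rcases h4 with h4 | h4 | h4
  · rcases case1 hA h1 h2 h34 h4 with h | h
    · exact Or.inl h
    · exact Or.inr (Or.inr h)
  · rcases case1 (swap12 hA) h2 h1 h34 h4 with h | h
    · exact Or.inr (Or.inl h)
    · exact Or.inr (Or.inr h)
  · exact Or.inr (Or.inr (case3 hA h1 h2 h34 h4))
end
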